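/- arXiv:1906.02621 — 2 statements merged into one kernel-verified Lean document; each statement's English description precedes it below -/
import Mathlib

section
/- Every binary linear code of length n at most 33 and dimension 5 in which every nonzero codeword has Hamming weight at least 15 contains a codeword of Hamming weight exactly 16. -/
open Finset in
/-- A linear functional over `ZMod 2` is nonzero on at most half of the space. -/
theorem two_mul_card_ne_zero_le {V : Type*} [AddCommGroup V] [Module (ZMod 2) V] [Fintype V]
    (f : V →ₗ[ZMod 2] ZMod 2) : 2 * #{v | f v ≠ 0} ≤ Fintype.card V := by
  classical
  have hsplit := card_filter_add_card_filter_not (s := (univ : Finset V)) (fun v => f v ≠ 0)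
  rw [card_univ] at hsplit
  suffices #{v | f v ≠ 0} ≤ #{v | ¬ f v ≠ 0} by omega
  by_cases h : ∃ v₀, f v₀ ≠ 0
  · obtain ⟨v₀, hv₀⟩ := h
    have key : ∀ a b : ZMod 2, a ≠ 0 → b ≠ 0 → a + b = 0 := by decide
    refine card_le_card_of_injOn (· + v₀) (fun v hv => ?_) (add_left_injective v₀).injOn
    simp only [coe_filter, mem_univ, true_and, Set.mem_ofPred_eq, not_not, map_add] at hv ⊢
    exact key _ _ hv hv₀
  · push Not at h
    simp [h]

open Finset in
/-- Average form of the Plotkin bound: the weights of a binary linear code of length `n`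
average to at most `n / 2`. -/
theorem two_mul_sum_hammingNorm_le {n : ℕ} {V : Type*} [AddCommGroup V] [Module (ZMod 2) V]
    [Fintype V] (g : V →ₗ[ZMod 2] (Fin n → ZMod 2)) :
    2 * ∑ v, hammingNorm (g v) ≤ n * Fintype.card V := by
  have hswap : ∑ v, hammingNorm (g v) = ∑ i, #{v | g v i ≠ 0} := by
    simp only [hammingNorm, card_filter]
    exact sum_comm
  rw [hswap, mul_sum]
  calc ∑ i, 2 * #{v | g v i ≠ 0} ≤ ∑ _i : Fin n, Fintype.card V :=
        sum_le_sum fun i _ => two_mul_card_ne_zero_le (LinearMap.proj i ∘ₗ g)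
    _ = n * Fintype.card V := by simp

open Finset in
/-- The coordinate sum of a binary word is the parity of its Hamming weight. -/
theorem sum_eq_hammingNorm_cast {n : ℕ} (c : Fin n → ZMod 2) :
    ∑ i, c i = (hammingNorm c : ZMod 2) := by
  have key : ∀ a : ZMod 2, a = if a ≠ 0 then 1 else 0 := by decide
  rw [hammingNorm, card_filter, Nat.cast_sum]
  refine sum_congr rfl fun i _ => ?_
  push_cast
  exact key (c i)

/-- Every binary linear code of length at most 33 and dimension 5 in which every
nonzero codeword has Hamming weight at least 15 contains a codeword of Hamming
weight exactly 16. -/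
theorem code_le33_5_15_has_weight_sixteen
    (n : ℕ) (hn : n ≤ 33)
    (C : Submodule (ZMod 2) (Fin n → ZMod 2))
    (hdim : Module.finrank (ZMod 2) C = 5)
    (hmin : ∀ c ∈ C, c ≠ 0 → 15 ≤ hammingNorm c) :
    ∃ c ∈ C, hammingNorm c = 16 := by
  classical
  by_contra! hne
  let parity : C →ₗ[ZMod 2] ZMod 2 := (∑ i, LinearMap.proj i) ∘ₗ C.subtype
  let D := LinearMap.ker parity
  let g : D →ₗ[ZMod 2] (Fin n → ZMod 2) := C.subtype ∘ₗ D.subtype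
  have hg : Function.Injective g := C.injective_subtype.comp D.injective_subtype
  have hrank : 4 ≤ Module.finrank (ZMod 2) D := by
    have h₁ := parity.finrank_range_add_finrank_ker
    have h₂ := Submodule.finrank_le (LinearMap.range parity)
    rw [Module.finrank_self] at h₂
    change _ + Module.finrank (ZMod 2) D = _ at h₁
    omega
  have := Fintype.ofFinite D
  have hcard : 16 ≤ Fintype.card D := by
    rw [Module.card_eq_pow_finrank (K := ZMod 2) (V := D), ZMod.card]
    exact Nat.pow_le_pow_right (n := 2) (by norm_num) hrank
  have hweight : ∀ d : D, d ≠ 0 → 18 ≤ hammingNorm (g d) := by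
    intro d hd
    have hmem : g d ∈ C := d.1.2
    have h15 := hmin (g d) hmem ((map_ne_zero_iff g hg).2 hd)
    have h16 := hne (g d) hmem
    have heven : Even (hammingNorm (g d)) := by
      rw [← ZMod.natCast_eq_zero_iff_even, ← sum_eq_hammingNorm_cast]
      have hker : parity d = 0 := LinearMap.mem_ker.1 d.2
      simp only [parity, LinearMap.comp_apply, LinearMap.sum_apply, LinearMap.proj_apply] at hker
      exact hker
    obtain ⟨k, hk⟩ := heven
    omega
  have hlower : (Fintype.card D - 1) * 18 ≤ ∑ d, hammingNorm (g d) := by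
    rw [← Finset.card_univ, ← Finset.card_erase_of_mem (Finset.mem_univ (0 : D)), ← smul_eq_mul]
    exact (Finset.card_nsmul_le_sum _ _ _ fun d hd => hweight d (Finset.ne_of_mem_erase hd)).trans
      (Finset.sum_le_sum_of_subset (Finset.erase_subset _ _))
  have hupper := two_mul_sum_hammingNorm_le g
  have hlength := Nat.mul_le_mul_right (Fintype.card D) hn
  omega
end

section
/- Every binary linear code of length n at most 47 and dimension 4 in which every nonzero codeword has Hamming weight at least 23 contains a codeword whose Hamming weight is 24, 25, or 26. -/
/-- An additive map to `ZMod 2` is nonzero on at most half of its domain. -/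
theorem two_mul_card_ne_zero_le_s11 {M : Type*} [AddCommGroup M] [Fintype M] (f : M →+ ZMod 2) :
    2 * (Finset.univ.filter fun x => f x ≠ 0).card ≤ Fintype.card M := by
  have hle : (Finset.univ.filter fun x => f x ≠ 0).card ≤
      (Finset.univ.filter fun x => ¬ f x ≠ 0).card := by
    by_cases h : ∃ a, f a ≠ 0
    · obtain ⟨a, ha⟩ := h
      refine Finset.card_le_card_of_injOn (fun x => x + a) (fun x hx => ?_)
        (add_left_injective a).injOn
      simp only [Finset.coe_filter, Finset.mem_univ, true_and, Set.mem_ofPred_eq] at hx ⊢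
      rw [map_add]
      revert hx ha
      generalize f x = u
      generalize f a = v
      revert u v
      decide
    · push Not at h
      simp [h]
  have := Finset.card_filter_add_card_filter_not (s := (Finset.univ : Finset M)) fun x => f x ≠ 0
  rw [Finset.card_univ] at this
  omega

/-- The parity of the Hamming weight of a binary word is the sum of its coordinates. -/
theorem hammingNorm_cast_zmod_two {ι : Type*} [Fintype ι] (c : ι → ZMod 2) :
    (hammingNorm c : ZMod 2) = ∑ i, c i := by
  rw [hammingNorm, Finset.natCast_card_filter]
  refine Finset.sum_congr rfl fun i _ => ?_
  generalize c i = u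
  revert u
  decide

/-- At most half of the words of a binary linear code have odd weight. -/
theorem two_mul_card_odd_hammingNorm_le {ι : Type*} [Fintype ι]
    (C : Submodule (ZMod 2) (ι → ZMod 2)) [Fintype C] :
    2 * (Finset.univ.filter fun c : C => Odd (hammingNorm (c : ι → ZMod 2))).card ≤
      Fintype.card C := by
  have h := two_mul_card_ne_zero_le_s11
    ((∑ i, LinearMap.proj i : (ι → ZMod 2) →ₗ[ZMod 2] ZMod 2) ∘ₗ C.subtype).toAddMonoidHom
  convert h using 4 with c
  simp only [LinearMap.toAddMonoidHom_coe, LinearMap.comp_apply, LinearMap.sum_apply,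
    LinearMap.proj_apply, Submodule.subtype_apply]
  rw [← hammingNorm_cast_zmod_two, ZMod.natCast_ne_zero_iff_odd]

/-- The average weight of a binary linear code is at most half of its length. -/
theorem two_mul_sum_hammingNorm_le_s11 {ι : Type*} [Fintype ι]
    (C : Submodule (ZMod 2) (ι → ZMod 2)) [Fintype C] :
    2 * ∑ c : C, hammingNorm (c : ι → ZMod 2) ≤ Fintype.card ι * Fintype.card C := by
  simp only [hammingNorm, Finset.card_filter]
  rw [Finset.sum_comm, Finset.mul_sum, ← smul_eq_mul (Fintype.card ι), ← Finset.card_univ]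
  refine Finset.sum_le_card_nsmul _ _ _ fun i _ => ?_
  rw [← Finset.card_filter]
  exact two_mul_card_ne_zero_le_s11
    ((LinearMap.proj i : (ι → ZMod 2) →ₗ[ZMod 2] ZMod 2) ∘ₗ C.subtype).toAddMonoidHom


/-- Every binary linear code of length at most 47 and dimension 4 in which every
nonzero codeword has Hamming weight at least 23 contains a codeword of Hamming
weight 24, 25 or 26. -/
theorem code_le47_4_23_has_weight_24_25_26
    (n : ℕ) (hn : n ≤ 47)
    (C : Submodule (ZMod 2) (Fin n → ZMod 2))
    (hdim : Module.finrank (ZMod 2) C = 4)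
    (hmin : ∀ c ∈ C, c ≠ 0 → 23 ≤ hammingNorm c) :
    ∃ c ∈ C, hammingNorm c = 24 ∨ hammingNorm c = 25 ∨ hammingNorm c = 26 := by
    classical
  by_contra! hno
  have hcard : Fintype.card C = 16 := by
    rw [Module.card_eq_pow_finrank (K := ZMod 2), hdim, ZMod.card]
    rfl
  have hodd := two_mul_card_odd_hammingNorm_le C
  have hsum := two_mul_sum_hammingNorm_le_s11 C
  rw [hcard] at hodd hsum
  rw [Fintype.card_fin] at hsum
  have hword (c : C) : 28 ≤ hammingNorm (c : Fin n → ZMod 2) +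
      5 * (if Odd (hammingNorm (c : Fin n → ZMod 2)) then 1 else 0) +
      28 * (if c = 0 then 1 else 0) := by
    by_cases hc : c = 0
    · simp [hc]
    · have h23 := hmin c c.2 (by simpa using hc)
      obtain ⟨h24, h25, h26⟩ := hno c c.2
      simp only [hc, if_false]
      split_ifs with ho
      · omega
      · rw [Nat.odd_iff] at ho
        omega
  have htotal := Finset.sum_le_sum fun (c : C) (_ : c ∈ Finset.univ) => hword c
  rw [Finset.sum_add_distrib, Finset.sum_add_distrib, ← Finset.mul_sum, ← Finset.mul_sum,
    ← Finset.card_filter, Finset.sum_const, Finset.card_univ, hcard] at htotal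
  simp only [Finset.sum_ite_eq', Finset.mem_univ, if_true, smul_eq_mul] at htotal
  omega
end
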